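/- For every n ∈ ℕ let (F_{n,k})_{k∈ℕ} be a filtration on a probability space (Ω, F, P) and let (D_{n,k})_{k≥1} be real random variables; let (s_n)_{n∈ℕ} be a sequence of natural numbers and s ∈ [0, ∞). Assume: (a) for all n and k ≥ 1, D_{n,k} is F_{n,k}-measurable, E[D_{n,k}²] < ∞ and P-a.s. E[D_{n,k} | F_{n,k−1}] = 0; (b) there exist a filtration (G_j)_{j∈ℕ} on (Ω, F) and a sequence of natural numbers (r_n)_{n∈ℕ} such that F_{n,0} = G_{r_n} for every n; (c) for every ε ∈ (0,1), P-a.s. lim_{n→∞} Σ_{k=1}^{s_n} E[D_{n,k}² · 1{|D_{n,k}| > ε} | F_{n,k−1}] = 0; (d) P-a.s. lim_{n→∞} Σ_{k=1}^{s_n} E[D_{n,k}² | F_{n,k−1}] = s. Set M_n = Σ_{k=1}^{s_n} D_{n,k}. Then for every λ ∈ ℝ, P-a.s. lim_{n→∞} E[exp(iλ M_n) | F_{n,0}] = exp(−s λ² / 2). -/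

import Mathlib

open MeasureTheory Filter Topology

theorem aux_maximal {Ω : Type*} {m0 : MeasurableSpace Ω} {μ : Measure Ω} [IsProbabilityMeasure μ]
    (𝒢 : Filtration ℕ m0) (Y : Ω → ℝ) (hY0 : 0 ≤ᵐ[μ] Y) (δ : NNReal) :
    (δ : ENNReal) * μ {ω | ∃ j, (δ : ℝ) ≤ (μ[Y | 𝒢 j]) ω} ≤ ENNReal.ofReal (∫ ω, Y ω ∂μ) := by
  have hsub := (martingale_condExp Y 𝒢 μ).submartingale.pos
  set f : ℕ → Ω → ℝ := (fun i => μ[Y | 𝒢 i])⁺ with hf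
  have hmon : Monotone (fun n : ℕ => {ω | (δ : ℝ) ≤ (Finset.range (n + 1)).sup'
      Finset.nonempty_range_add_one fun k => f k ω}) := by
    intro a b hab ω hω
    simp only [Set.mem_ofPred_eq, Finset.le_sup'_iff] at hω ⊢
    obtain ⟨k, hk, h⟩ := hω
    exact ⟨k, by simp at hk ⊢; omega, h⟩
  have hsubset : {ω | ∃ j, (δ : ℝ) ≤ (μ[Y | 𝒢 j]) ω} ⊆ ⋃ n : ℕ, {ω | (δ : ℝ) ≤ (Finset.range (n + 1)).sup'
      Finset.nonempty_range_add_one fun k => f k ω} := by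
    rintro ω ⟨j, hj⟩
    simp only [Set.mem_iUnion, Set.mem_ofPred_eq, Finset.le_sup'_iff]
    refine ⟨j, j, by simp, hj.trans ?_⟩
    simp only [hf]
    exact le_posPart _
  refine (mul_le_mul_right (measure_mono hsubset) _).trans ?_
  rw [hmon.measure_iUnion, ENNReal.mul_iSup]
  refine iSup_le fun n => ?_
  refine (maximal_ineq hsub (by intro i ω; exact posPart_nonneg _) n).trans ?_
  apply ENNReal.ofReal_le_ofReal
  have hfn : f n =ᵐ[μ] μ[Y | 𝒢 n] := by
    filter_upwards [condExp_nonneg (m := 𝒢 n) hY0] with ω hω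
    simp only [hf]
    exact posPart_of_nonneg hω
  calc _ ≤ ∫ ω, f n ω ∂μ := by
        apply setIntegral_le_integral
        · exact hsub.integrable n
        · exact Eventually.of_forall fun ω => posPart_nonneg _
    _ = ∫ ω, (μ[Y | 𝒢 n]) ω ∂μ := integral_congr_ae hfn
    _ = _ := integral_condExp (𝒢.le n)

theorem aux_key {Ω : Type*} {m0 : MeasurableSpace Ω} {μ : Measure Ω} [IsProbabilityMeasure μ]
    (𝒢 : Filtration ℕ m0) (r : ℕ → ℕ) (X : ℕ → Ω → ℂ) (C : ℝ)
    (hm : ∀ n, AEStronglyMeasurable (X n) μ) (hC : ∀ n, ∀ᵐ ω ∂μ, ‖X n ω‖ ≤ C)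
    (hX : ∀ᵐ ω ∂μ, Tendsto (fun n => X n ω) atTop (𝓝 0)) :
    ∀ᵐ ω ∂μ, Tendsto (fun n => (μ[X n | 𝒢 (r n)]) ω) atTop (𝓝 0) := by
  have hC' := ae_all_iff.2 hC
  set Y : ℕ → Ω → ℝ := fun N ω => ⨆ k, ‖X (N + k) ω‖ with hYdef
  have hYm : ∀ N, AEMeasurable (Y N) μ := fun N =>
    AEMeasurable.iSup fun k => (hm (N + k)).norm.aemeasurable
  have hY0 : ∀ N ω, 0 ≤ Y N ω := fun N ω => Real.iSup_nonneg fun k => norm_nonneg _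
  have hYC : ∀ N, ∀ᵐ ω ∂μ, ‖Y N ω‖ ≤ C := by
    intro N
    filter_upwards [hC'] with ω h
    rw [Real.norm_of_nonneg (hY0 _ _)]
    exact ciSup_le fun k => h _
  have hYi : ∀ N, Integrable (Y N) μ := fun N =>
    Integrable.of_bound (hYm N).aestronglyMeasurable C (hYC N)
  have hlim : Tendsto (fun N => ∫ ω, Y N ω ∂μ) atTop (𝓝 0) := by
    have := tendsto_integral_of_dominated_convergence (μ := μ) (F := Y) (f := fun _ => 0)
      (fun _ => C) (fun N => (hYm N).aestronglyMeasurable) (integrable_const _) hYC ?_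
    · simpa using this
    filter_upwards [hX] with ω h
    rw [Metric.tendsto_atTop] at h ⊢
    intro ε hε
    obtain ⟨N, hN⟩ := h (ε / 2) (half_pos hε)
    refine ⟨N, fun n hn => ?_⟩
    rw [Real.dist_eq, sub_zero, abs_of_nonneg (hY0 _ _)]
    refine lt_of_le_of_lt (ciSup_le fun k => ?_) (half_lt_self hε)
    have := hN (n + k) (by omega)
    rw [dist_zero_right] at this
    exact this.le
  have hdom : ∀ᵐ ω ∂μ, ∀ N n, N ≤ n → ‖(μ[X n | 𝒢 (r n)]) ω‖ ≤ (μ[Y N | 𝒢 (r n)]) ω := by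
    rw [ae_all_iff]; intro N
    rw [ae_all_iff]; intro n
    by_cases hNn : N ≤ n
    swap
    · exact Eventually.of_forall fun ω h => absurd h hNn
    have hXi : Integrable (X n) μ := Integrable.of_bound (hm n) C (hC n)
    have h2 := condExp_mono (m := 𝒢 (r n)) (μ := μ) hXi.norm (hYi N) (by
      filter_upwards [hC'] with ω h
      obtain ⟨k, rfl⟩ := Nat.exists_eq_add_of_le hNn
      exact le_ciSup (f := fun k => ‖X (N + k) ω‖) ⟨C, by rintro _ ⟨k, rfl⟩; exact h _⟩ k)
    filter_upwards [norm_condExp_le (m := 𝒢 (r n)) (μ := μ) (X n), h2] with ω h1 h2 _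
    exact h1.trans h2
  have hδ : ∀ δ : NNReal, 0 < δ → ∀ᵐ ω ∂μ, ∀ᶠ n in atTop, ‖(μ[X n | 𝒢 (r n)]) ω‖ < δ := by
    intro δ hδ
    rw [ae_iff]
    set A := {ω | ¬ ∀ᶠ n in atTop, ‖(μ[X n | 𝒢 (r n)]) ω‖ < δ} with hA
    have hle : ∀ N, (δ : ENNReal) * μ A ≤ ENNReal.ofReal (∫ ω, Y N ω ∂μ) := by
      intro N
      refine le_trans ?_ (aux_maximal 𝒢 (Y N) (Eventually.of_forall (hY0 N)) δ)
      refine mul_le_mul_right (measure_mono_ae ?_) _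
      filter_upwards [hdom] with ω h hω
      have hω1 : ω ∈ A := hω
      have hω' : ∃ᶠ n in atTop, ¬ ‖(μ[X n | 𝒢 (r n)]) ω‖ < δ := by
        simpa only [hA, Set.mem_ofPred_eq, not_eventually] using hω1
      obtain ⟨n, hn, hn'⟩ := (frequently_atTop.1 hω') N
      exact ⟨r n, (not_lt.1 hn').trans (h N n hn)⟩
    have h0 : Tendsto (fun N => ENNReal.ofReal (∫ ω, Y N ω ∂μ)) atTop (𝓝 0) := by
      simpa using ENNReal.tendsto_ofReal hlim
    have := ge_of_tendsto' h0 hle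
    have h3 := le_antisymm this zero_le
    rcases mul_eq_zero.1 h3 with h | h
    · simp at h; exact absurd h hδ.ne'
    · exact h
  have hall : ∀ᵐ ω ∂μ, ∀ k : ℕ, ∀ᶠ n in atTop, ‖(μ[X n | 𝒢 (r n)]) ω‖ < 1 / ((k : ℝ) + 1) := by
    rw [ae_all_iff]; intro k
    have := hδ (1 / ((k : NNReal) + 1)) (by positivity)
    simpa using this
  filter_upwards [hall] with ω h
  rw [tendsto_zero_iff_norm_tendsto_zero, Metric.tendsto_nhds]
  intro ε hε
  obtain ⟨k, hk⟩ := exists_nat_one_div_lt hε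
  filter_upwards [h k] with n hn
  simpa using hn.trans hk

theorem aux_exp1 (x : ℝ) : ‖Complex.exp ((x : ℂ) * Complex.I) - 1 - (x : ℂ) * Complex.I
    + ((x ^ 2 / 2 : ℝ) : ℂ)‖ ≤ 4 * min (|x| ^ 3) (x ^ 2) := by
  have hxn : ‖(x : ℂ) * Complex.I‖ = |x| := by simp
  have hsq : x ^ 2 = |x| ^ 2 := (sq_abs x).symm
  have h0 : 0 ≤ |x| := abs_nonneg x
  rcases le_total |x| 1 with h | h
  · have h1 := Complex.exp_bound (x := (x : ℂ) * Complex.I) (by rw [hxn]; exact h) (n := 3) (by norm_num)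
    have heq : Complex.exp ((x : ℂ) * Complex.I) - 1 - (x : ℂ) * Complex.I
      + ((x ^ 2 / 2 : ℝ) : ℂ) = Complex.exp ((x : ℂ) * Complex.I) -
        ∑ m ∈ Finset.range 3, ((x : ℂ) * Complex.I) ^ m / (m.factorial : ℂ) := by
      simp [Finset.sum_range_succ, mul_pow, Complex.I_sq, Nat.factorial]
      ring
    rw [heq]
    refine h1.trans ?_
    rw [hxn]
    norm_num [Nat.factorial]
    have h3 : |x| ^ 3 ≤ x ^ 2 := by rw [hsq]; exact pow_le_pow_of_le_one h0 h (by norm_num)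
    rw [min_eq_left h3]
    nlinarith [pow_nonneg h0 3]
  · have h3 : x ^ 2 ≤ |x| ^ 3 := by rw [hsq]; exact pow_le_pow_right₀ h (by norm_num)
    rw [min_eq_right h3]
    have hn1 : ‖Complex.exp ((x : ℂ) * Complex.I)‖ = 1 := Complex.norm_exp_ofReal_mul_I x
    have hn2 : ‖((x ^ 2 / 2 : ℝ) : ℂ)‖ = x ^ 2 / 2 := by
      rw [Complex.norm_real, Real.norm_of_nonneg (by positivity)]
    refine (norm_add_le _ _).trans ?_
    have := (norm_sub_le (Complex.exp ((x : ℂ) * Complex.I) - 1) ((x : ℂ) * Complex.I))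
    have h5 := (norm_sub_le (Complex.exp ((x : ℂ) * Complex.I)) 1)
    rw [hn2]
    rw [hxn] at this
    rw [hn1, norm_one] at h5
    nlinarith

theorem aux_exp2 (y : ℝ) (hy : 0 ≤ y) : |Real.exp (-y) - 1 + y| ≤ y ^ 2 := by
  rcases le_total y 1 with h | h
  · have := Real.norm_exp_sub_one_sub_id_le (x := -y) (by rw [norm_neg, Real.norm_of_nonneg hy]; exact h)
    simpa using this
  · have h1 : Real.exp (-y) ≤ 1 := Real.exp_le_one_iff.2 (by linarith)
    have h2 := Real.exp_pos (-y)
    rw [abs_le]; constructor <;> nlinarith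

theorem aux_pull {Ω : Type*} {m m0 : MeasurableSpace Ω} {μ : Measure Ω}
    {f g : Ω → ℂ} (hf : StronglyMeasurable[m] f) (hfg : Integrable (fun ω => f ω * g ω) μ)
    (hg : Integrable g μ) :
    μ[fun ω => f ω * g ω | m] =ᵐ[μ] fun ω => f ω * (μ[g | m]) ω := by
  exact condExp_bilin_of_stronglyMeasurable_left (ContinuousLinearMap.mul ℝ ℂ) hf hfg hg

theorem aux_C {Ω : Type*} {m m0 : MeasurableSpace Ω} {μ : Measure Ω} [IsProbabilityMeasure μ]
    (hm : m ≤ m0) (d : Ω → ℝ) (hd : StronglyMeasurable d)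
    (hd2 : Integrable (fun ω => d ω ^ 2) μ) (hmart : μ[d | m] =ᵐ[μ] 0) (lam ε : ℝ) (hε : 0 < ε) :
    ∀ᵐ ω ∂μ, ‖(μ[fun ω' => Complex.exp (((lam * d ω' : ℝ) : ℂ) * Complex.I) -
        ((Real.exp (-(lam ^ 2 * (μ[fun ω => d ω ^ 2 | m]) ω' / 2)) : ℝ) : ℂ) | m]) ω‖ ≤
      4 * |lam| ^ 3 * ε * (μ[fun ω => d ω ^ 2 | m]) ω +
      4 * lam ^ 2 * (μ[fun ω => d ω ^ 2 * Set.indicator {ω'' | ε < |d ω''|} (fun _ => (1 : ℝ)) ω | m]) ω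
      + lam ^ 4 * (μ[fun ω => d ω ^ 2 | m]) ω ^ 2 / 4 := by
  have hdi : Integrable d μ := by
    have : MemLp d 2 μ := (memLp_two_iff_integrable_sq hd.aestronglyMeasurable).2 hd2
    exact this.integrable (by norm_num)
  set σ := μ[fun ω => d ω ^ 2 | m] with hσ
  have hσm : StronglyMeasurable[m] σ := stronglyMeasurable_condExp
  have hσ0 : 0 ≤ᵐ[μ] σ := condExp_nonneg (Eventually.of_forall fun ω => sq_nonneg _)
  have hmeasInd : Measurable (Set.indicator {ω'' | ε < |d ω''|} (fun _ => (1 : ℝ))) :=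
    measurable_const.indicator (measurableSet_lt measurable_const hd.measurable.abs)
  have hdind : Integrable (fun ω => d ω ^ 2 *
      Set.indicator {ω'' | ε < |d ω''|} (fun _ => (1 : ℝ)) ω) μ := by
    refine hd2.mono (by fun_prop) (Eventually.of_forall fun ω => ?_)
    rw [norm_mul]
    refine mul_le_of_le_one_right (norm_nonneg _) ?_
    by_cases h : ω ∈ {ω'' | ε < |d ω''|} <;> simp [Set.indicator, h]
  set G : Ω → ℂ := fun ω => Complex.exp (((lam * d ω : ℝ) : ℂ) * Complex.I) - 1
    - ((lam * d ω : ℝ) : ℂ) * Complex.I + (((lam * d ω) ^ 2 / 2 : ℝ) : ℂ) with hG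
  set H : Ω → ℝ := fun ω => (4 * |lam| ^ 3 * ε) * (d ω ^ 2) + (4 * lam ^ 2) * (d ω ^ 2 *
      Set.indicator {ω'' | ε < |d ω''|} (fun _ => (1 : ℝ)) ω) with hH
  have hHi : Integrable H μ := (hd2.const_mul _).add (hdind.const_mul _)
  have hGH : ∀ ω, ‖G ω‖ ≤ H ω := by
    intro ω
    refine (aux_exp1 (lam * d ω)).trans ?_
    simp only [hH]
    by_cases h : ε < |d ω|
    · have : ω ∈ {ω'' | ε < |d ω''|} := h
      rw [Set.indicator_of_mem this]
      have h1 := min_le_right (|lam * d ω| ^ 3) ((lam * d ω) ^ 2)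
      have h2 : 0 ≤ 4 * |lam| ^ 3 * ε * d ω ^ 2 := by positivity
      nlinarith
    · have : ω ∉ {ω'' | ε < |d ω''|} := h
      rw [Set.indicator_of_notMem this]
      have h1 := min_le_left (|lam * d ω| ^ 3) ((lam * d ω) ^ 2)
      have h2 : |lam * d ω| ^ 3 ≤ |lam| ^ 3 * ε * d ω ^ 2 := by
        rw [abs_mul, mul_pow, ← sq_abs (d ω), mul_assoc]
        refine mul_le_mul_of_nonneg_left ?_ (by positivity)
        have := mul_le_mul_of_nonneg_right (not_lt.1 h) (sq_nonneg |d ω|)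
        linarith [pow_succ |d ω| 2]
      linarith
  have hdm := hd.measurable
  have hGm : Measurable G := by fun_prop
  have hGi : Integrable G μ := hHi.mono' hGm.aestronglyMeasurable (Eventually.of_forall hGH)
  have hGle : ∀ᵐ ω ∂μ, ‖(μ[G | m]) ω‖ ≤ (μ[H | m]) ω := by
    filter_upwards [norm_condExp_le (m := m) (μ := μ) G,
      condExp_mono (m := m) hGi.norm hHi (Eventually.of_forall hGH)] with ω h1 h2
    exact h1.trans h2
  have hHc : μ[H | m] =ᵐ[μ] fun ω => (4 * |lam| ^ 3 * ε) * σ ω + (4 * lam ^ 2) *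
      (μ[fun ω => d ω ^ 2 * Set.indicator {ω'' | ε < |d ω''|} (fun _ => (1 : ℝ)) ω | m]) ω := by
    have h1 := condExp_add (m := m) (hd2.const_mul (4 * |lam| ^ 3 * ε)) (hdind.const_mul (4 * lam ^ 2))
    have h2 := condExp_smul (μ := μ) (4 * |lam| ^ 3 * ε) (fun ω => d ω ^ 2) m
    have h3 := condExp_smul (μ := μ) (4 * lam ^ 2) (fun ω => d ω ^ 2 *
      Set.indicator {ω'' | ε < |d ω''|} (fun _ => (1 : ℝ)) ω) m
    filter_upwards [h1, h2, h3] with ω h1 h2 h3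
    refine h1.trans ?_
    exact congrArg₂ (· + ·) h2 h3
  -- decomposition
  set T1 : ℝ →L[ℝ] ℂ := ((lam : ℂ) * Complex.I) • Complex.ofRealCLM with hT1
  set T2 : ℝ →L[ℝ] ℂ := ((lam : ℂ) ^ 2 / 2) • Complex.ofRealCLM with hT2
  set e : Ω → ℂ := fun ω => 1 - ((Real.exp (-(lam ^ 2 * σ ω / 2)) : ℝ) : ℂ) with he
  have hem : StronglyMeasurable[m] e := by
    have : Measurable[m] σ := hσm.measurable
    have : Measurable[m] e := by fun_prop
    exact this.stronglyMeasurable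
  have hei : Integrable e μ := by
    refine Integrable.of_bound (hem.mono hm).aestronglyMeasurable 2 ?_
    filter_upwards [hσ0] with ω h
    refine (norm_sub_le _ _).trans ?_
    rw [Complex.norm_real, Real.norm_of_nonneg (Real.exp_pos _).le, norm_one]
    have : Real.exp (-(lam ^ 2 * σ ω / 2)) ≤ 1 := Real.exp_le_one_iff.2 (by
      have : 0 ≤ σ ω := h
      have : 0 ≤ lam ^ 2 * σ ω / 2 := by positivity
      linarith)
    linarith
  have hdec : (fun ω' => Complex.exp (((lam * d ω' : ℝ) : ℂ) * Complex.I) -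
        ((Real.exp (-(lam ^ 2 * σ ω' / 2)) : ℝ) : ℂ)) =
      (G + T1 ∘ d) - T2 ∘ (fun ω => d ω ^ 2) + e := by
    funext ω
    simp [hG, hT1, hT2, he]
    ring
  have hT1i := T1.integrable_comp hdi
  have hT2i := T2.integrable_comp hd2
  have e1 := condExp_add (m := m) hGi hT1i
  have e2 := condExp_sub (m := m) (hGi.add hT1i) hT2i
  have e3 := condExp_add (m := m) ((hGi.add hT1i).sub hT2i) hei
  have e4 := T1.comp_condExp_comm (m := m) hdi
  have e5 := T2.comp_condExp_comm (m := m) hd2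
  rw [hdec]
  have e6 := condExp_of_stronglyMeasurable hm hem hei
  filter_upwards [hGle, hHc, e1, e2, e3, e4, e5, hmart, hσ0] with ω hGle hHc e1 e2 e3 e4 e5 hmart hσ0
  have hfin : (μ[(G + T1 ∘ d) - T2 ∘ (fun ω => d ω ^ 2) + e | m]) ω =
      (μ[G | m]) ω + ((-(Real.exp (-(lam ^ 2 * σ ω / 2)) - 1 + lam ^ 2 * σ ω / 2) : ℝ) : ℂ) := by
    refine e3.trans ?_
    rw [Pi.add_apply, e6]
    refine (congrArg (· + e ω) (e2.trans (congrArg₂ (· - ·) (e1.trans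
      (congrArg ((μ[G | m]) ω + ·) e4.symm)) e5.symm))).trans ?_
    simp only [Function.comp_apply, hmart, he, hT2]
    simp
    ring
  rw [hfin]
  refine (norm_add_le _ _).trans ?_
  rw [hHc] at hGle
  have h0 : 0 ≤ σ ω := hσ0
  have := aux_exp2 (lam ^ 2 * σ ω / 2) (by positivity)
  rw [Complex.norm_real, norm_neg, Real.norm_eq_abs]
  have h7 : (lam ^ 2 * σ ω / 2) ^ 2 = lam ^ 4 * σ ω ^ 2 / 4 := by ring
  linarith

/-- truncation weight -/
noncomputable def auxc (K : ℝ) (σ : ℕ → ℝ) (k : ℕ) : ℝ :=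
  if ∑ i ∈ Finset.range (k + 1), σ i ≤ K then 1 else 0

noncomputable def auxZ (lam K : ℝ) (σ d : ℕ → ℝ) (k : ℕ) : ℂ :=
  Complex.exp (((lam * ∑ i ∈ Finset.range k, auxc K σ i * d i : ℝ) : ℂ) * Complex.I +
    ((lam ^ 2 * (∑ i ∈ Finset.range k, auxc K σ i * σ i) / 2 : ℝ) : ℂ))

noncomputable def auxB (lam K : ℝ) (σ d : ℕ → ℝ) (k : ℕ) : ℂ :=
  (auxc K σ k : ℂ) * auxZ lam K σ d k * ((Real.exp (lam ^ 2 * σ k / 2) : ℝ) : ℂ)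

noncomputable def auxW (lam : ℝ) (σ d : ℝ) : ℂ :=
  Complex.exp (((lam * d : ℝ) : ℂ) * Complex.I) - ((Real.exp (-(lam ^ 2 * σ / 2)) : ℝ) : ℂ)

theorem auxZ_step (lam K : ℝ) (σ d : ℕ → ℝ) (k : ℕ) :
    auxZ lam K σ d (k + 1) - auxZ lam K σ d k = auxB lam K σ d k * auxW lam (σ k) (d k) := by
  have hc : auxc K σ k = 1 ∨ auxc K σ k = 0 := by unfold auxc; split_ifs <;> simp
  rcases hc with hc | hc
  · simp only [auxB, auxW, hc]
    simp only [auxZ, Finset.sum_range_succ, hc, mul_sub, Complex.ofReal_exp]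
    simp only [Complex.ofReal_one, one_mul, ← Complex.exp_add]
    congr 2 <;> push_cast <;> ring
  · simp only [auxB, hc]
    simp [auxZ, Finset.sum_range_succ, hc]

theorem auxZ_zero (lam K : ℝ) (σ d : ℕ → ℝ) : auxZ lam K σ d 0 = 1 := by simp [auxZ]

theorem auxc_nonneg (K : ℝ) (σ : ℕ → ℝ) (k : ℕ) : 0 ≤ auxc K σ k := by
  unfold auxc; split_ifs <;> simp

theorem auxc_le_one (K : ℝ) (σ : ℕ → ℝ) (k : ℕ) : auxc K σ k ≤ 1 := by
  unfold auxc; split_ifs <;> simp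

theorem auxc_sum_le' (K : ℝ) (σ : ℕ → ℝ) (hσ : ∀ i, 0 ≤ σ i) (k : ℕ) :
    ∑ i ∈ Finset.range k, auxc K σ i * σ i ≤ ∑ i ∈ Finset.range k, σ i :=
  Finset.sum_le_sum fun i _ => mul_le_of_le_one_left (hσ i) (auxc_le_one K σ i)

theorem auxc_sum_le (K : ℝ) (hK : 0 ≤ K) (σ : ℕ → ℝ) (hσ : ∀ i, 0 ≤ σ i) (k : ℕ) :
    ∑ i ∈ Finset.range k, auxc K σ i * σ i ≤ K := by
  induction k with
  | zero => simpa using hK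
  | succ k ih =>
    by_cases h : ∑ i ∈ Finset.range (k + 1), σ i ≤ K
    · exact (auxc_sum_le' K σ hσ _).trans h
    · rw [Finset.sum_range_succ]
      simpa [auxc, h] using ih

theorem auxZ_norm (lam K : ℝ) (σ d : ℕ → ℝ) (k : ℕ) :
    ‖auxZ lam K σ d k‖ = Real.exp (lam ^ 2 * (∑ i ∈ Finset.range k, auxc K σ i * σ i) / 2) := by
  rw [auxZ, Complex.exp_add, norm_mul, Complex.norm_exp_ofReal_mul_I, one_mul,
    ← Complex.ofReal_exp, Complex.norm_real, Real.norm_of_nonneg (Real.exp_pos _).le]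

theorem auxZ_norm_le (lam K : ℝ) (hK : 0 ≤ K) (σ d : ℕ → ℝ) (hσ : ∀ i, 0 ≤ σ i) (k : ℕ) :
    ‖auxZ lam K σ d k‖ ≤ Real.exp (lam ^ 2 * K / 2) := by
  rw [auxZ_norm]
  have := auxc_sum_le K hK σ hσ k
  gcongr

theorem auxB_norm_le (lam K : ℝ) (σ d : ℕ → ℝ) (hσ : ∀ i, 0 ≤ σ i) (k : ℕ) :
    ‖auxB lam K σ d k‖ ≤ auxc K σ k * Real.exp (lam ^ 2 * K / 2) := by
  rw [auxB, norm_mul, norm_mul, auxZ_norm, Complex.norm_real, Complex.norm_real,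
    Real.norm_of_nonneg (Real.exp_pos _).le, Real.norm_of_nonneg (auxc_nonneg _ _ _), mul_assoc,
    ← Real.exp_add]
  by_cases h : ∑ i ∈ Finset.range (k + 1), σ i ≤ K
  · refine mul_le_mul_of_nonneg_left ?_ (auxc_nonneg _ _ _)
    rw [Real.exp_le_exp]
    have h1 := auxc_sum_le' K σ hσ k
    rw [Finset.sum_range_succ] at h
    have h2 : lam ^ 2 * (∑ i ∈ Finset.range k, auxc K σ i * σ i + σ k) ≤ lam ^ 2 * K :=
      mul_le_mul_of_nonneg_left (by linarith) (sq_nonneg _)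
    linarith
  · simp [auxc, h]

theorem auxc_meas {Ω : Type*} {m : MeasurableSpace Ω} (K : ℝ) (σ : ℕ → Ω → ℝ) (k : ℕ)
    (hσ : ∀ i ≤ k, Measurable (σ i)) : Measurable (fun ω => auxc K (fun i => σ i ω) k) := by
  unfold auxc
  refine Measurable.ite (measurableSet_le ?_ measurable_const) measurable_const measurable_const
  exact Finset.measurable_sum _ fun i hi => hσ i (by simp at hi; omega)

theorem auxZ_meas {Ω : Type*} {m : MeasurableSpace Ω} (lam K : ℝ) (σ d : ℕ → Ω → ℝ) (k : ℕ)
    (hσ : ∀ i < k, Measurable (σ i)) (hd : ∀ i < k, Measurable (d i)) :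
    Measurable (fun ω => auxZ lam K (fun i => σ i ω) (fun i => d i ω) k) := by
  unfold auxZ
  have h1 : Measurable (fun ω => ∑ i ∈ Finset.range k, auxc K (fun i => σ i ω) i * d i ω) :=
    Finset.measurable_sum _ fun i hi => by
      have hi := Finset.mem_range.1 hi
      exact (auxc_meas K σ i (fun j hj => hσ j (by omega))).mul (hd i hi)
  have h2 : Measurable (fun ω => ∑ i ∈ Finset.range k, auxc K (fun i => σ i ω) i * σ i ω) :=
    Finset.measurable_sum _ fun i hi => by
      have hi := Finset.mem_range.1 hi
      exact (auxc_meas K σ i (fun j hj => hσ j (by omega))).mul (hσ i hi)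
  fun_prop

theorem auxB_meas {Ω : Type*} {m : MeasurableSpace Ω} (lam K : ℝ) (σ d : ℕ → Ω → ℝ) (k : ℕ)
    (hσ : ∀ i ≤ k, Measurable (σ i)) (hd : ∀ i < k, Measurable (d i)) :
    Measurable (fun ω => auxB lam K (fun i => σ i ω) (fun i => d i ω) k) := by
  unfold auxB
  have h1 := auxc_meas K σ k hσ
  have h2 := auxZ_meas lam K σ d k (fun i hi => hσ i hi.le) hd
  have h3 := hσ k le_rfl
  fun_prop

theorem auxW_norm_le (lam σ d : ℝ) (hσ : 0 ≤ σ) : ‖auxW lam σ d‖ ≤ 2 := by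
  unfold auxW
  refine (norm_sub_le _ _).trans ?_
  rw [Complex.norm_exp_ofReal_mul_I, Complex.norm_real, Real.norm_of_nonneg (Real.exp_pos _).le]
  have : Real.exp (-(lam ^ 2 * σ / 2)) ≤ 1 := Real.exp_le_one_iff.2 (by
    have : 0 ≤ lam ^ 2 * σ / 2 := by positivity
    linarith)
  linarith

/-- the compensator sum -/
noncomputable def auxS {Ω : Type*} {m0 : MeasurableSpace Ω} (μ : Measure Ω) (F : Filtration ℕ m0)
    (lam K : ℝ) (σ d : ℕ → Ω → ℝ) (N : ℕ) (ω : Ω) : ℂ :=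
  ∑ k ∈ Finset.range N, auxB lam K (fun i => σ i ω) (fun i => d i ω) k *
    (μ[fun ω' => auxW lam (σ k ω') (d k ω') | F k]) ω

/-- the remainder -/
noncomputable def auxX {Ω : Type*} {m0 : MeasurableSpace Ω} (μ : Measure Ω) (F : Filtration ℕ m0)
    (lam K E : ℝ) (σ d : ℕ → Ω → ℝ) (N : ℕ) (ω : Ω) : ℂ :=
  (E : ℂ) * Complex.exp (((lam * ∑ i ∈ Finset.range N, d i ω : ℝ) : ℂ) * Complex.I)
    - auxZ lam K (fun i => σ i ω) (fun i => d i ω) N + auxS μ F lam K σ d N ω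

theorem aux_B {Ω : Type*} {m0 : MeasurableSpace Ω} {μ : Measure Ω} [IsProbabilityMeasure μ]
    (F : Filtration ℕ m0) (d σ : ℕ → Ω → ℝ) (hd : ∀ i, Measurable[F (i + 1)] (d i))
    (hσ : ∀ i, Measurable[F i] (σ i)) (hσ0 : ∀ i, 0 ≤ᵐ[μ] σ i)
    (lam K E : ℝ) (N : ℕ) :
    AEStronglyMeasurable (auxX μ F lam K E σ d N) μ ∧
    μ[auxX μ F lam K E σ d N | F 0] =ᵐ[μ] fun ω =>
      (E : ℂ) * (μ[fun ω' => Complex.exp (((lam * ∑ i ∈ Finset.range N, d i ω' : ℝ) : ℂ)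
        * Complex.I) | F 0]) ω - 1 := by
  have hσ0' : ∀ᵐ ω ∂μ, ∀ i, 0 ≤ σ i ω := ae_all_iff.2 hσ0
  have hdm : ∀ i, Measurable (d i) := fun i => (hd i).mono (F.le _) le_rfl
  have hσm : ∀ i, Measurable (σ i) := fun i => (hσ i).mono (F.le _) le_rfl
  have hBm : ∀ k, Measurable[F k] (fun ω => auxB lam K (fun i => σ i ω) (fun i => d i ω) k) :=
    fun k => auxB_meas (m := F k) lam K σ d k (fun i hi => (hσ i).mono (F.mono hi) le_rfl)
      (fun i hi => (hd i).mono (F.mono hi) le_rfl)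
  have hWm : ∀ k, Measurable (fun ω => auxW lam (σ k ω) (d k ω)) := by
    intro k; unfold auxW
    have := hdm k
    have := hσm k
    fun_prop
  have hWi : ∀ k, Integrable (fun ω => auxW lam (σ k ω) (d k ω)) μ := fun k =>
    Integrable.of_bound (hWm k).aestronglyMeasurable 2 (by
      filter_upwards [hσ0'] with ω h
      exact auxW_norm_le _ _ _ (h k))
  have hBm' : ∀ k, Measurable (fun ω => auxB lam K (fun i => σ i ω) (fun i => d i ω) k) :=
    fun k => (hBm k).mono (F.le _) le_rfl
  have hBb : ∀ k, ∀ᵐ ω ∂μ, ‖auxB lam K (fun i => σ i ω) (fun i => d i ω) k‖ ≤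
      Real.exp (lam ^ 2 * K / 2) := by
    intro k
    filter_upwards [hσ0'] with ω h
    exact (auxB_norm_le lam K _ _ h k).trans
      (mul_le_of_le_one_left (Real.exp_pos _).le (auxc_le_one _ _ _))
  have hBWi : ∀ k, Integrable (fun ω => auxB lam K (fun i => σ i ω) (fun i => d i ω) k *
      auxW lam (σ k ω) (d k ω)) μ := fun k =>
    (hWi k).bdd_mul (hBm' k).aestronglyMeasurable (hBb k)
  have hBEi : ∀ k, Integrable (fun ω => auxB lam K (fun i => σ i ω) (fun i => d i ω) k *
      (μ[fun ω' => auxW lam (σ k ω') (d k ω') | F k]) ω) μ := fun k =>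
    integrable_condExp.bdd_mul (hBm' k).aestronglyMeasurable (hBb k)
  set f : ℕ → Ω → ℂ := fun k ω => auxB lam K (fun i => σ i ω) (fun i => d i ω) k *
      (μ[fun ω' => auxW lam (σ k ω') (d k ω') | F k]) ω - 
      auxB lam K (fun i => σ i ω) (fun i => d i ω) k * auxW lam (σ k ω) (d k ω) with hf
  have hfi : ∀ k, Integrable (f k) μ := fun k => (hBEi k).sub (hBWi k)
  have hf0 : ∀ k, μ[f k | F 0] =ᵐ[μ] 0 := by
    intro k
    have h1 := aux_pull (hBm k).stronglyMeasurable (hBWi k) (hWi k)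
    have h2 := condExp_sub (m := F 0) (hBEi k) (hBWi k)
    have h3 := condExp_congr_ae (m := F 0) h1
    have h4 := condExp_condExp_of_le (f := fun ω => auxB lam K (fun i => σ i ω) (fun i => d i ω) k *
      auxW lam (σ k ω) (d k ω)) (μ := μ) (F.mono (Nat.zero_le k)) (F.le k)
    filter_upwards [h2, h3, h4] with ω h2 h3 h4
    refine h2.trans ?_
    rw [Pi.sub_apply, ← h3, h4, sub_self]; rfl
  set g : Ω → ℂ := fun ω => Complex.exp (((lam * ∑ i ∈ Finset.range N, d i ω : ℝ) : ℂ)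
        * Complex.I) with hg
  have hgm : Measurable g := by
    have : Measurable (fun ω => ∑ i ∈ Finset.range N, d i ω) :=
      Finset.measurable_sum _ fun i _ => hdm i
    fun_prop
  have hgi : Integrable g μ := Integrable.of_bound hgm.aestronglyMeasurable 1
    (Eventually.of_forall fun ω => (Complex.norm_exp_ofReal_mul_I _).le)
  have hdec : auxX μ F lam K E σ d N = (E • g - fun _ => (1 : ℂ)) + ∑ k ∈ Finset.range N, f k := by
    funext ω
    have htel := Finset.sum_range_sub (auxZ lam K (fun i => σ i ω) (fun i => d i ω)) N
    simp only [auxZ_step, auxZ_zero] at htel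
    simp only [auxX, auxS, Pi.add_apply, Pi.sub_apply, Pi.smul_apply, Finset.sum_apply, hf,
      Finset.sum_sub_distrib, htel, hg, Complex.real_smul]
    ring
  have hEg : Integrable (E • g) μ := hgi.smul E
  have h1i : Integrable (fun _ : Ω => (1 : ℂ)) μ := integrable_const _
  have hsi : Integrable (∑ k ∈ Finset.range N, f k) μ := integrable_finsetSum' _ fun k _ => hfi k
  rw [hdec]
  refine ⟨((hEg.sub h1i).add hsi).aestronglyMeasurable, ?_⟩
  have e1 := condExp_add (m := F 0) (hEg.sub h1i) hsi
  have e2 := condExp_sub (m := F 0) hEg h1i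
  have e3 := condExp_smul (μ := μ) E g (F 0)
  have e4 := condExp_finsetSum (μ := μ) (m := F 0) (s := Finset.range N) (f := f) fun k _ => hfi k
  have e5 := ae_all_iff.2 hf0
  have e6 : μ[fun _ : Ω => (1 : ℂ) | F 0] = fun _ => 1 := condExp_const (F.le 0) _
  filter_upwards [e1, e2, e3, e4, e5] with ω e1 e2 e3 e4 e5
  rw [e1, Pi.add_apply, e2, Pi.sub_apply, e3, e4, e6, Finset.sum_apply]
  simp [e5]

theorem aux_S_bound (lam K ε : ℝ) (hK : 0 ≤ K) (σ d : ℕ → ℝ) (hσ : ∀ i, 0 ≤ σ i)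
    (L : ℕ → ℝ) (w : ℕ → ℂ)
    (hw : ∀ i, ‖w i‖ ≤ 4 * |lam| ^ 3 * ε * σ i + 4 * lam ^ 2 * L i + lam ^ 4 * σ i ^ 2 / 4)
    (N : ℕ) : ‖∑ k ∈ Finset.range N, auxB lam K σ d k * w k‖ ≤ Real.exp (lam ^ 2 * K / 2) *
      ∑ k ∈ Finset.range N, auxc K σ k *
        (4 * |lam| ^ 3 * ε * σ k + 4 * lam ^ 2 * L k + lam ^ 4 * σ k ^ 2 / 4) := by
  refine (norm_sum_le _ _).trans ?_
  rw [Finset.mul_sum]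
  refine Finset.sum_le_sum fun k _ => ?_
  rw [norm_mul]
  refine (mul_le_mul (auxB_norm_le lam K σ d hσ k) (hw k) (norm_nonneg _)
    (mul_nonneg (auxc_nonneg _ _ _) (Real.exp_pos _).le)).trans (le_of_eq (by ring))

theorem aux_S_bdd (lam K : ℝ) (hK : 0 ≤ K) (σ d : ℕ → ℝ) (hσ : ∀ i, 0 ≤ σ i)
    (L : ℕ → ℝ) (hL : ∀ i, L i ≤ σ i) (w : ℕ → ℂ)
    (hw : ∀ i, ‖w i‖ ≤ 4 * |lam| ^ 3 * (1 / 2) * σ i + 4 * lam ^ 2 * L i + lam ^ 4 * σ i ^ 2 / 4)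
    (N : ℕ) : ‖∑ k ∈ Finset.range N, auxB lam K σ d k * w k‖ ≤ Real.exp (lam ^ 2 * K / 2) *
      ((2 * |lam| ^ 3 + 4 * lam ^ 2 + lam ^ 4 * K / 4) * K) := by
  refine (aux_S_bound lam K (1 / 2) hK σ d hσ L w hw N).trans ?_
  refine mul_le_mul_of_nonneg_left ?_ (Real.exp_pos _).le
  have h1 := auxc_sum_le K hK σ hσ N
  have h2 : ∀ k, auxc K σ k *
      (4 * |lam| ^ 3 * (1 / 2) * σ k + 4 * lam ^ 2 * L k + lam ^ 4 * σ k ^ 2 / 4) ≤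
      (2 * |lam| ^ 3 + 4 * lam ^ 2 + lam ^ 4 * K / 4) * (auxc K σ k * σ k) := by
    intro k
    by_cases h : ∑ i ∈ Finset.range (k + 1), σ i ≤ K
    · have hc : auxc K σ k = 1 := by simp [auxc, h]
      have hk : σ k ≤ K := (Finset.single_le_sum (fun i _ => hσ i) (by simp)).trans h
      rw [hc]
      have h3 : lam ^ 2 * L k ≤ lam ^ 2 * σ k := mul_le_mul_of_nonneg_left (hL k) (sq_nonneg _)
      have h4 : lam ^ 4 * (σ k * σ k) ≤ lam ^ 4 * (K * σ k) :=
        mul_le_mul_of_nonneg_left (mul_le_mul_of_nonneg_right hk (hσ k)) (by positivity)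
      nlinarith
    · simp [auxc, h]
  refine (Finset.sum_le_sum fun k _ => h2 k).trans ?_
  rw [← Finset.mul_sum]
  exact mul_le_mul_of_nonneg_left h1 (by positivity)

theorem aux_S_small (lam K ε : ℝ) (hK : 0 ≤ K) (hε : 0 < ε) (σ d : ℕ → ℝ) (hσ : ∀ i, 0 ≤ σ i)
    (L : ℕ → ℝ) (hL0 : ∀ i, 0 ≤ L i) (hL : ∀ i, σ i ≤ ε ^ 2 + L i) (w : ℕ → ℂ)
    (hw : ∀ i, ‖w i‖ ≤ 4 * |lam| ^ 3 * ε * σ i + 4 * lam ^ 2 * L i + lam ^ 4 * σ i ^ 2 / 4)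
    (N : ℕ) : ‖∑ k ∈ Finset.range N, auxB lam K σ d k * w k‖ ≤ Real.exp (lam ^ 2 * K / 2) *
      (4 * |lam| ^ 3 * ε * (∑ k ∈ Finset.range N, σ k) +
        4 * lam ^ 2 * (∑ k ∈ Finset.range N, L k) +
        lam ^ 4 / 4 * ((ε ^ 2 + ∑ k ∈ Finset.range N, L k) * ∑ k ∈ Finset.range N, σ k)) := by
  refine (aux_S_bound lam K ε hK σ d hσ L w hw N).trans ?_
  refine mul_le_mul_of_nonneg_left ?_ (Real.exp_pos _).le
  rw [Finset.mul_sum, Finset.mul_sum, Finset.mul_sum, Finset.mul_sum, ← Finset.sum_add_distrib,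
    ← Finset.sum_add_distrib]
  refine Finset.sum_le_sum fun k hk => ?_
  have h0 : 0 ≤ 4 * |lam| ^ 3 * ε * σ k + 4 * lam ^ 2 * L k + lam ^ 4 * σ k ^ 2 / 4 :=
    (norm_nonneg _).trans (hw k)
  refine (mul_le_of_le_one_left h0 (auxc_le_one _ _ _)).trans ?_
  have h1 : L k ≤ ∑ k ∈ Finset.range N, L k := Finset.single_le_sum (fun i _ => hL0 i) hk
  have h2 : σ k * σ k ≤ (ε ^ 2 + ∑ k ∈ Finset.range N, L k) * σ k :=
    mul_le_mul_of_nonneg_right (by linarith [hL k]) (hσ k)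
  have h3 := mul_le_mul_of_nonneg_left h2 (show 0 ≤ lam ^ 4 / 4 by positivity)
  nlinarith

theorem auxZ_eq (lam K : ℝ) (σ d : ℕ → ℝ) (hσ : ∀ i, 0 ≤ σ i) (N : ℕ)
    (hV : ∑ i ∈ Finset.range N, σ i ≤ K) :
    auxZ lam K σ d N = Complex.exp (((lam * ∑ i ∈ Finset.range N, d i : ℝ) : ℂ) * Complex.I) *
      ((Real.exp (lam ^ 2 * (∑ i ∈ Finset.range N, σ i) / 2) : ℝ) : ℂ) := by
  have hc : ∀ i ∈ Finset.range N, auxc K σ i = 1 := by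
    intro i hi
    have hi := Finset.mem_range.1 hi
    have : ∑ j ∈ Finset.range (i + 1), σ j ≤ K :=
      (Finset.sum_le_sum_of_subset_of_nonneg (Finset.range_mono (by omega))
        (fun j _ _ => hσ j)).trans hV
    simp [auxc, this]
  have h1 : ∑ i ∈ Finset.range N, auxc K σ i * d i = ∑ i ∈ Finset.range N, d i :=
    Finset.sum_congr rfl fun i hi => by rw [hc i hi, one_mul]
  have h2 : ∑ i ∈ Finset.range N, auxc K σ i * σ i = ∑ i ∈ Finset.range N, σ i :=
    Finset.sum_congr rfl fun i hi => by rw [hc i hi, one_mul]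
  rw [auxZ, h1, h2, Complex.exp_add, Complex.ofReal_exp]

theorem aux_core {Ω : Type*} {m0 : MeasurableSpace Ω} {μ : Measure Ω} [IsProbabilityMeasure μ]
    (ℱ : ℕ → Filtration ℕ m0) (d : ℕ → ℕ → Ω → ℝ) (s : ℕ → ℕ) (sl : ℝ) (hsl : 0 ≤ sl)
    (hdm : ∀ n i, StronglyMeasurable[(ℱ n) (i + 1)] (d n i))
    (hd2 : ∀ n i, Integrable (fun ω => (d n i ω) ^ 2) μ)
    (hmart : ∀ n i, μ[d n i | (ℱ n) i] =ᵐ[μ] 0)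
    (𝒢 : Filtration ℕ m0) (r : ℕ → ℕ) (hb : ∀ n, (ℱ n) 0 = 𝒢 (r n))
    (hc : ∀ ε : ℝ, ε ∈ Set.Ioo (0 : ℝ) 1 → ∀ᵐ ω ∂μ,
      Tendsto (fun n => ∑ i ∈ Finset.range (s n),
          (μ[fun ω' => (d n i ω') ^ 2 *
              Set.indicator {ω'' | ε < |d n i ω''|} (fun _ => (1 : ℝ)) ω' | (ℱ n) i]) ω)
        atTop (𝓝 (0 : ℝ)))
    (hd : ∀ᵐ ω ∂μ,
      Tendsto (fun n => ∑ i ∈ Finset.range (s n),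
          (μ[fun ω' => (d n i ω') ^ 2 | (ℱ n) i]) ω) atTop (𝓝 sl))
    (lam : ℝ) :
    ∀ᵐ ω ∂μ, Tendsto
      (fun n => (μ[fun ω' => Complex.exp
          (((lam * ∑ i ∈ Finset.range (s n), d n i ω' : ℝ) : ℂ) * Complex.I) | (ℱ n) 0]) ω)
      atTop (𝓝 ((Real.exp (-(sl * lam ^ 2) / 2) : ℝ) : ℂ)) := by
  set σ : ℕ → ℕ → Ω → ℝ := fun n i => μ[fun ω' => (d n i ω') ^ 2 | (ℱ n) i] with hσdef
  set L : ℝ → ℕ → ℕ → Ω → ℝ := fun ε n i => μ[fun ω' => (d n i ω') ^ 2 *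
              Set.indicator {ω'' | ε < |d n i ω''|} (fun _ => (1 : ℝ)) ω' | (ℱ n) i] with hLdef
  set K : ℝ := sl + 1 with hKdef
  have hK : 0 ≤ K := by positivity
  set E : ℝ := Real.exp (lam ^ 2 * sl / 2) with hE
  set w : ℕ → ℕ → Ω → ℂ := fun n k => μ[fun ω' => auxW lam (σ n k ω') (d n k ω') | (ℱ n) k] with hw
  have hdm' : ∀ n i, StronglyMeasurable (d n i) := fun n i => (hdm n i).mono ((ℱ n).le _)
  have hσm : ∀ n i, Measurable[(ℱ n) i] (σ n i) := fun n i =>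
    stronglyMeasurable_condExp.measurable
  have hσ0n : ∀ n i, 0 ≤ᵐ[μ] σ n i := fun n i =>
    condExp_nonneg (Eventually.of_forall fun ω => sq_nonneg _)
  have hσ0 : ∀ᵐ ω ∂μ, ∀ n i, 0 ≤ σ n i ω := by
    rw [ae_all_iff]; intro n; rw [ae_all_iff]; intro i; exact hσ0n n i
  have hind : ∀ (ε : ℝ) n i, Integrable (fun ω => d n i ω ^ 2 *
      Set.indicator {ω'' | ε < |d n i ω''|} (fun _ => (1 : ℝ)) ω) μ := by
    intro ε n i
    have hmeasInd : Measurable (Set.indicator {ω'' | ε < |d n i ω''|} (fun _ => (1 : ℝ))) :=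
      measurable_const.indicator (measurableSet_lt measurable_const (hdm' n i).measurable.abs)
    have := (hdm' n i).measurable
    refine (hd2 n i).mono (by fun_prop) (Eventually.of_forall fun ω => ?_)
    rw [norm_mul]
    refine mul_le_of_le_one_right (norm_nonneg _) ?_
    by_cases h : ω ∈ {ω'' | ε < |d n i ω''|} <;> simp [Set.indicator, h]
  have hL0 : ∀ ε : ℝ, ∀ᵐ ω ∂μ, ∀ n i, 0 ≤ L ε n i ω := by
    intro ε
    rw [ae_all_iff]; intro n; rw [ae_all_iff]; intro i
    refine condExp_nonneg (Eventually.of_forall fun ω => ?_)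
    exact mul_nonneg (sq_nonneg _) (Set.indicator_nonneg (fun _ _ => zero_le_one) _)
  have hLσ : ∀ ε : ℝ, ∀ᵐ ω ∂μ, ∀ n i, L ε n i ω ≤ σ n i ω := by
    intro ε
    rw [ae_all_iff]; intro n; rw [ae_all_iff]; intro i
    refine condExp_mono (hind ε n i) (hd2 n i) (Eventually.of_forall fun ω => ?_)
    refine mul_le_of_le_one_right (sq_nonneg _) ?_
    by_cases h : ω ∈ {ω'' | ε < |d n i ω''|} <;> simp [Set.indicator, h]
  have hσL : ∀ ε : ℝ, ∀ᵐ ω ∂μ, ∀ n i, σ n i ω ≤ ε ^ 2 + L ε n i ω := by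
    intro ε
    rw [ae_all_iff]; intro n; rw [ae_all_iff]; intro i
    have h1 := condExp_mono (m := (ℱ n) i) (hd2 n i) ((integrable_const (μ := μ) (ε ^ 2)).add (hind ε n i))
      (Eventually.of_forall fun ω => ?_)
    · have h2 := condExp_add (m := (ℱ n) i) (integrable_const (μ := μ) (ε ^ 2)) (hind ε n i)
      filter_upwards [h1, h2] with ω h1 h2
      refine h1.trans (h2.le.trans ?_)
      rw [Pi.add_apply, condExp_const ((ℱ n).le i)]
    · simp only [Pi.add_apply]
      by_cases h : ε < |d n i ω|
      · have : ω ∈ {ω'' | ε < |d n i ω''|} := h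
        rw [Set.indicator_of_mem this]
        nlinarith [sq_nonneg ε]
      · have : ω ∉ {ω'' | ε < |d n i ω''|} := h
        rw [Set.indicator_of_notMem this, mul_zero, add_zero, ← sq_abs (d n i ω)]
        have := not_lt.1 h
        exact pow_le_pow_left₀ (abs_nonneg _) this 2
  have hwb : ∀ ε : ℝ, 0 < ε → ∀ᵐ ω ∂μ, ∀ n i, ‖w n i ω‖ ≤
      4 * |lam| ^ 3 * ε * σ n i ω + 4 * lam ^ 2 * L ε n i ω + lam ^ 4 * σ n i ω ^ 2 / 4 := by
    intro ε hε
    rw [ae_all_iff]; intro n; rw [ae_all_iff]; intro i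
    exact aux_C ((ℱ n).le i) (d n i) (hdm' n i) (hd2 n i) (hmart n i) lam ε hε
  set X : ℕ → Ω → ℂ := fun n => auxX μ (ℱ n) lam K E (σ n) (d n) (s n) with hX
  have hB := fun n => aux_B (μ := μ) (ℱ n) (d n) (σ n) (fun i => (hdm n i).measurable) (hσm n)
    (hσ0n n) lam K E (s n)
  have hXb : ∀ n, ∀ᵐ ω ∂μ, ‖X n ω‖ ≤ E + Real.exp (lam ^ 2 * K / 2) +
      Real.exp (lam ^ 2 * K / 2) * ((2 * |lam| ^ 3 + 4 * lam ^ 2 + lam ^ 4 * K / 4) * K) := by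
    intro n
    filter_upwards [hσ0, hLσ (1 / 2), hwb (1 / 2) (by norm_num)] with ω h1 h2 h3
    have hS := aux_S_bdd lam K hK (fun i => σ n i ω) (fun i => d n i ω) (h1 n)
      (fun i => L (1 / 2) n i ω) (h2 n) (fun i => w n i ω) (h3 n) (s n)
    have hZ := auxZ_norm_le lam K hK (fun i => σ n i ω) (fun i => d n i ω) (h1 n) (s n)
    refine (norm_add_le _ _).trans (add_le_add ((norm_sub_le _ _).trans (add_le_add ?_ hZ)) hS)
    rw [norm_mul, Complex.norm_exp_ofReal_mul_I, mul_one, Complex.norm_real,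
      Real.norm_of_nonneg (Real.exp_pos _).le]
  have hεk : ∀ k : ℕ, (1 / ((k : ℝ) + 2)) ∈ Set.Ioo (0 : ℝ) 1 := by
    intro k
    refine ⟨by positivity, ?_⟩
    rw [div_lt_one (by positivity)]
    have : (0 : ℝ) ≤ k := by positivity
    linarith
  have hXlim : ∀ᵐ ω ∂μ, Tendsto (fun n => X n ω) atTop (𝓝 0) := by
    have a1 := ae_all_iff.2 fun k : ℕ => hL0 (1 / ((k : ℝ) + 2))
    have a2 := ae_all_iff.2 fun k : ℕ => hσL (1 / ((k : ℝ) + 2))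
    have a3 := ae_all_iff.2 fun k : ℕ => hwb (1 / ((k : ℝ) + 2)) (hεk k).1
    have a4 := ae_all_iff.2 fun k : ℕ => hc (1 / ((k : ℝ) + 2)) (hεk k)
    filter_upwards [hσ0, hd, a1, a2, a3, a4] with ω h0 hd a1 a2 a3 a4
    have hS : Tendsto (fun n => auxS μ (ℱ n) lam K (σ n) (d n) (s n) ω) atTop (𝓝 0) := by
      have hg : Tendsto (fun k : ℕ => Real.exp (lam ^ 2 * K / 2) *
          (4 * |lam| ^ 3 * (1 / ((k : ℝ) + 2)) * sl + 4 * lam ^ 2 * 0 +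
          lam ^ 4 / 4 * (((1 / ((k : ℝ) + 2)) ^ 2 + 0) * sl))) atTop (𝓝 0) := by
        have ht : Tendsto (fun k : ℕ => 1 / ((k : ℝ) + 2)) atTop (𝓝 0) := by
          have := (tendsto_add_atTop_iff_nat 1).2 (tendsto_one_div_add_atTop_nhds_zero_nat (𝕜 := ℝ))
          refine this.congr fun k => ?_
          push_cast; ring
        have hcont : Continuous (fun x : ℝ => Real.exp (lam ^ 2 * K / 2) *
          (4 * |lam| ^ 3 * x * sl + 4 * lam ^ 2 * 0 + lam ^ 4 / 4 * ((x ^ 2 + 0) * sl))) := by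
          fun_prop
        have := (hcont.tendsto 0).comp ht
        simpa [Function.comp_def] using this
      rw [tendsto_zero_iff_norm_tendsto_zero, Metric.tendsto_nhds]
      intro δ hδ
      obtain ⟨k, hk⟩ := (hg.eventually (gt_mem_nhds hδ)).exists
      have hub : Tendsto (fun n => Real.exp (lam ^ 2 * K / 2) *
          (4 * |lam| ^ 3 * (1 / ((k : ℝ) + 2)) * (∑ i ∈ Finset.range (s n), σ n i ω) +
          4 * lam ^ 2 * (∑ i ∈ Finset.range (s n), L (1 / ((k : ℝ) + 2)) n i ω) +
          lam ^ 4 / 4 * (((1 / ((k : ℝ) + 2)) ^ 2 +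
            ∑ i ∈ Finset.range (s n), L (1 / ((k : ℝ) + 2)) n i ω) *
            ∑ i ∈ Finset.range (s n), σ n i ω))) atTop (𝓝 (Real.exp (lam ^ 2 * K / 2) *
          (4 * |lam| ^ 3 * (1 / ((k : ℝ) + 2)) * sl + 4 * lam ^ 2 * 0 +
          lam ^ 4 / 4 * (((1 / ((k : ℝ) + 2)) ^ 2 + 0) * sl)))) := by
        have hdL := a4 k
        exact (((hd.const_mul _).add (hdL.const_mul _)).add
          (((hdL.const_add _).mul hd).const_mul _)).const_mul _
      filter_upwards [hub.eventually (gt_mem_nhds hk)] with n hn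
      rw [Real.dist_eq, sub_zero, abs_norm]
      refine lt_of_le_of_lt ?_ hn
      exact aux_S_small lam K (1 / ((k : ℝ) + 2)) hK (hεk k).1 (fun i => σ n i ω)
        (fun i => d n i ω) (h0 n) (fun i => L (1 / ((k : ℝ) + 2)) n i ω) (a1 k n) (a2 k n)
        (fun i => w n i ω) (a3 k n) (s n)
    have hEZ : Tendsto (fun n => (E : ℂ) * Complex.exp (((lam * ∑ i ∈ Finset.range (s n), d n i ω : ℝ) : ℂ)
        * Complex.I) - auxZ lam K (fun i => σ n i ω) (fun i => d n i ω) (s n)) atTop (𝓝 0) := by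
      have h1 : Tendsto (fun n => |E - Real.exp (lam ^ 2 * (∑ i ∈ Finset.range (s n), σ n i ω) / 2)|)
          atTop (𝓝 0) := by
        have hcont : Continuous (fun x : ℝ => |E - Real.exp (lam ^ 2 * x / 2)|) := by fun_prop
        have := (hcont.tendsto sl).comp hd
        simpa [Function.comp_def, hE] using this
      rw [tendsto_zero_iff_norm_tendsto_zero]
      refine h1.congr' ?_
      filter_upwards [hd.eventually (gt_mem_nhds (show sl < K by linarith))] with n hn
      rw [auxZ_eq lam K _ _ (h0 n) (s n) hn.le, mul_comm (E : ℂ), ← mul_sub, norm_mul,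
        Complex.norm_exp_ofReal_mul_I, one_mul, ← Complex.ofReal_sub, Complex.norm_real,
        Real.norm_eq_abs]
    have := hEZ.add hS
    rw [add_zero] at this
    exact this
  have hkey := aux_key 𝒢 r X _ (fun n => (hB n).1) hXb hXlim
  have hBall := ae_all_iff.2 fun n => (hB n).2
  filter_upwards [hkey, hBall] with ω h1 h2
  have h3 : Tendsto (fun n => (E : ℂ) * (μ[fun ω' => Complex.exp
      (((lam * ∑ i ∈ Finset.range (s n), d n i ω' : ℝ) : ℂ) * Complex.I) | (ℱ n) 0]) ω - 1)
      atTop (𝓝 0) := by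
    refine h1.congr fun n => ?_
    rw [← h2 n, hb n]
  have hEinv : ((Real.exp (-(sl * lam ^ 2) / 2) : ℝ) : ℂ) * (E : ℂ) = 1 := by
    rw [hE, ← Complex.ofReal_mul, ← Real.exp_add]
    have : -(sl * lam ^ 2) / 2 + lam ^ 2 * sl / 2 = 0 := by ring
    rw [this]; simp
  have h4 := (h3.add_const 1).const_mul ((Real.exp (-(sl * lam ^ 2) / 2) : ℝ) : ℂ)
  rw [zero_add, mul_one] at h4
  refine h4.congr fun n => ?_
  rw [sub_add_cancel, ← mul_assoc, hEinv, one_mul]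

theorem aux_sum_Icc {M : Type*} [AddCommMonoid M] (f : ℕ → M) (N : ℕ) :
    ∑ k ∈ Finset.Icc 1 N, f k = ∑ i ∈ Finset.range N, f (i + 1) := by
  induction N with
  | zero => simp
  | succ N ih => rw [Finset.sum_Icc_succ_top (by omega), ih, Finset.sum_range_succ]

/-- conditional martingale CLT, Proposition 3.8 of the paper.
For every `n`, `(ℱ n k)ₖ` is a filtration and `(D n k)` are square-integrable martingale
differences; `ℱ n 0 = 𝒢 (r n)` for some filtration `𝒢`; under the conditional Lindeberg
condition and a.s. convergence of the sum of conditional variances to `sl`, the conditional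
characteristic functions of `M n = ∑_{k=1}^{s n} D n k` given `ℱ n 0` converge a.s. to
`exp (- sl λ² / 2)`. -/
theorem stmt1 {Ω : Type*} {m0 : MeasurableSpace Ω} {μ : Measure Ω} [IsProbabilityMeasure μ]
    (ℱ : ℕ → Filtration ℕ m0) (D : ℕ → ℕ → Ω → ℝ) (s : ℕ → ℕ) (sl : ℝ) (hsl : 0 ≤ sl)
    (ha_meas : ∀ n k, 1 ≤ k → StronglyMeasurable[(ℱ n) k] (D n k))
    (ha_int : ∀ n k, 1 ≤ k → Integrable (fun ω => (D n k ω) ^ 2) μ)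
    (ha_mart : ∀ n k, 1 ≤ k → μ[D n k | (ℱ n) (k - 1)] =ᵐ[μ] 0)
    (𝒢 : Filtration ℕ m0) (r : ℕ → ℕ) (hb : ∀ n, (ℱ n) 0 = 𝒢 (r n))
    (hc : ∀ ε : ℝ, ε ∈ Set.Ioo (0 : ℝ) 1 → ∀ᵐ ω ∂μ,
      Tendsto (fun n => ∑ k ∈ Finset.Icc 1 (s n),
          (μ[fun ω' => (D n k ω') ^ 2 *
              Set.indicator {ω'' | ε < |D n k ω''|} (fun _ => (1 : ℝ)) ω' | (ℱ n) (k - 1)]) ω)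
        atTop (𝓝 (0 : ℝ)))
    (hd : ∀ᵐ ω ∂μ,
      Tendsto (fun n => ∑ k ∈ Finset.Icc 1 (s n),
          (μ[fun ω' => (D n k ω') ^ 2 | (ℱ n) (k - 1)]) ω) atTop (𝓝 sl))
    (lam : ℝ) :
    ∀ᵐ ω ∂μ, Tendsto
      (fun n => (μ[fun ω' => Complex.exp
          (((lam * ∑ k ∈ Finset.Icc 1 (s n), D n k ω' : ℝ) : ℂ) * Complex.I) | (ℱ n) 0]) ω)
      atTop (𝓝 ((Real.exp (-(sl * lam ^ 2) / 2) : ℝ) : ℂ)) := by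
  simp only [aux_sum_Icc] at hc hd ⊢
  exact aux_core ℱ (fun n i => D n (i + 1)) s sl hsl (fun n i => ha_meas n (i + 1) (by omega))
    (fun n i => ha_int n (i + 1) (by omega)) (fun n i => ha_mart n (i + 1) (by omega)) 𝒢 r hb hc hd lam
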